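/- Let X := ℙ^{n_1} × ⋯ × ℙ^{n_k} with k ≥ 2 and all n_i ≥ 1. Fix (a_1,…,a_k) ∈ ℕ^k with a_i > 0 for all i, an integer s with 0 < s < ∏_{i=1}^k C(n_i + a_i, n_i), and an index i ∈ {1,…,k}. Let Z ⊂ X be a general subset of cardinality s. Then Z equals the scheme-theoretic base locus of the linear system |I_Z((a_1,…,a_k) + ε_i)|. -/

import Mathlib

/-!
Core framework: a concrete algebraic model of the multiprojective space
`X = ℙ^{n 0} × ⋯ × ℙ^{n (k-1)}` over a field `K`, via its multihomogeneous
coordinate ring `R = K[x_{ij}]`.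
-/

open MvPolynomial Module
open scoped TensorProduct

namespace MultiProjPaper

variable (K : Type) [Field K] (k : ℕ) (n : Fin k → ℕ)

/-- Index type of the variables `x_{ij}`, `i = 1, …, k`, `0 ≤ j ≤ n i`. -/
abbrev MPIdx := Σ i : Fin k, Fin (n i + 1)

/-- The multihomogeneous coordinate ring `R = K[x_{ij}]` of the multiprojective space. -/
abbrev MPR := MvPolynomial (MPIdx k n) K

/-- The weight of the variable `x_{ij}` is the multiindex `ε_i`. -/
def mpWeight : MPIdx k n → (Fin k → ℕ) := fun x => Pi.single x.1 1

/-- The space of multihomogeneous polynomials of multidegree `a`, i.e. `H^0(X, O_X(a))`. -/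
noncomputable def mcomp (a : Fin k → ℕ) : Submodule K (MPR K k n) :=
  weightedHomogeneousSubmodule K (mpWeight k n) a

/-- A (representative of a) point of `X`: a tuple of nonzero vectors. -/
structure MPPoint where
  v : ∀ i : Fin k, Fin (n i + 1) → K
  nz : ∀ i, v i ≠ 0

/-- Evaluation of a polynomial at (a representative of) a point. -/
noncomputable def MPPoint.ev (P : MPPoint K k n) (f : MPR K k n) : K :=
  MvPolynomial.eval (fun x : MPIdx k n => P.v x.1 x.2) f

/-- Evaluation at a scaling (by `lam i` on the `i`-th group of variables) of a point. -/
noncomputable def coneEval (lam : Fin k → K) (P : MPPoint K k n) (f : MPR K k n) : K :=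
  MvPolynomial.eval (fun x : MPIdx k n => lam x.1 * P.v x.1 x.2) f

/-- The (multihomogeneous, saturated) vanishing ideal of a set of points of `X`:
all polynomials vanishing on the affine multicone over the set. -/
noncomputable def vanIdeal (S : Set (MPPoint K k n)) : Ideal (MPR K k n) where
  carrier := {f | ∀ P ∈ S, ∀ lam : Fin k → K, coneEval K k n lam P f = 0}
  add_mem' := by
    intro f g hf hg P hP lam
    simp only [coneEval, map_add] at *
    rw [hf P hP lam, hg P hP lam, add_zero]
  zero_mem' := by intro P hP lam; simp [coneEval]
  smul_mem' := by
    intro c f hf P hP lam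
    simp only [coneEval, smul_eq_mul, map_mul] at *
    rw [hf P hP lam, mul_zero]

/-- `H^0(X, 𝓘(a))` for the sheaf of ideals associated to a multihomogeneous ideal `I`:
the multidegree-`a` component of `I`. -/
noncomputable def secI (I : Ideal (MPR K k n)) (a : Fin k → ℕ) : Submodule K (MPR K k n) :=
  mcomp K k n a ⊓ (Submodule.restrictScalars K I)

/-- `h^0(X, 𝓘(a))`. -/
noncomputable def h0I (I : Ideal (MPR K k n)) (a : Fin k → ℕ) : ℕ :=
  finrank K ↥(secI K k n I a)

/-- A zero-dimensional closed subscheme `Z ⊂ X`, modeled by its saturated multihomogeneous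
ideal `I`, together with its degree (= length) `deg`: the multigraded Hilbert function of
`R/I` is eventually constant, equal to `deg`. -/
structure ZeroDimClosed where
  I : Ideal (MPR K k n)
  homog : ∀ f ∈ I, ∀ a : Fin k → ℕ, weightedHomogeneousComponent (mpWeight k n) a f ∈ I
  saturated : ∀ f : MPR K k n,
    (∀ g : ∀ i : Fin k, Fin (n i + 1), (∏ i : Fin k, X (⟨i, g i⟩ : MPIdx k n)) * f ∈ I) → f ∈ I
  deg : ℕ
  hilb : ∃ d₀ : ℕ, ∀ a : Fin k → ℕ, (∀ i, d₀ ≤ a i) →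
    finrank K ↥(secI K k n I a) + deg = finrank K ↥(mcomp K k n a)

/-- `h^0(X, 𝓘_Z(a))` for a zero-dimensional closed subscheme `Z`. -/
noncomputable def h0Z (Z : ZeroDimClosed K k n) (a : Fin k → ℕ) : ℕ := h0I K k n Z.I a

/-- `h^1(X, 𝓘_Z(a))` for a zero-dimensional closed subscheme `Z` and `a ∈ ℕ^k`:
from the exact sequence `0 → 𝓘_Z(a) → O_X(a) → O_Z(a) → 0` and `h^1(O_X(a)) = 0`,
`h^1(𝓘_Z(a)) = deg Z - (h^0(O_X(a)) - h^0(𝓘_Z(a)))`. -/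
noncomputable def h1Z (Z : ZeroDimClosed K k n) (a : Fin k → ℕ) : ℤ :=
  (Z.deg : ℤ) + (h0Z K k n Z a : ℤ) - (finrank K ↥(mcomp K k n a) : ℤ)

/-- "A general tuple of `s` points of `X` satisfies `P`": there is a nonzero polynomial `F`
in the coordinates of the representative vectors of the `s` points (i.e. a nonempty Zariski
open subset of `X^s`) such that every tuple of points where `F` does not vanish satisfies `P`. -/
def GenericPts (s : ℕ) (P : (Fin s → MPPoint K k n) → Prop) : Prop :=
  ∃ F : MvPolynomial (Fin s × MPIdx k n) K, F ≠ 0 ∧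
    ∀ T : Fin s → MPPoint K k n,
      MvPolynomial.eval (fun q : Fin s × MPIdx k n => (T q.1).v q.2.1 q.2.2) F ≠ 0 → P T

/-- "A general tuple of `d` vectors of the `K`-vector space `V` satisfies `P`":
there is a nonzero polynomial in the coordinates (w.r.t. a fixed basis) of the `d` vectors
such that every tuple where it does not vanish satisfies `P`. -/
def GenericVecs (V : Type) [AddCommGroup V] [Module K V] (d : ℕ)
    (P : (Fin d → V) → Prop) : Prop :=
  ∃ F : MvPolynomial (Fin d × (Basis.ofVectorSpaceIndex K V)) K, F ≠ 0 ∧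
    ∀ w : Fin d → V,
      MvPolynomial.eval
        (fun q : Fin d × (Basis.ofVectorSpaceIndex K V) =>
          (Basis.ofVectorSpace K V).repr (w q.1) q.2) F ≠ 0 → P w

/-- Multiplication `H^0(O_X(c)) ⊗ H^0(𝓘(a)) → H^0(𝓘(a + c))` as a bilinear map. -/
noncomputable def mulSec (I : Ideal (MPR K k n)) (c a : Fin k → ℕ) :
    ↥(mcomp K k n c) →ₗ[K] ↥(secI K k n I a) →ₗ[K] ↥(secI K k n I (a + c)) :=
  LinearMap.mk₂ K
    (fun f g => ⟨(f : MPR K k n) * (g : MPR K k n), by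
      constructor
      · have hf : IsWeightedHomogeneous (mpWeight k n) (f : MPR K k n) c := f.2
        have hg : IsWeightedHomogeneous (mpWeight k n) (g : MPR K k n) a := g.2.1
        have := hf.mul hg
        rw [add_comm c a] at this
        exact this
      · exact Ideal.mul_mem_left _ _ g.2.2⟩)
    (fun f f' g => by apply Subtype.ext; simp [add_mul])
    (fun c' f g => by apply Subtype.ext; simp [smul_eq_mul]; try ring)
    (fun f g g' => by apply Subtype.ext; simp [mul_add])
    (fun c' f g => by apply Subtype.ext; simp [smul_eq_mul]; try ring)

/-- The multiplication map `μ : H^0(O_X(c)) ⊗ H^0(𝓘(a)) → H^0(𝓘(a+c))`. -/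
noncomputable def mulMap (I : Ideal (MPR K k n)) (c a : Fin k → ℕ) :
    (↥(mcomp K k n c) ⊗[K] ↥(secI K k n I a)) →ₗ[K] ↥(secI K k n I (a + c)) :=
  TensorProduct.lift (mulSec K k n I c a)

end MultiProjPaper

namespace MultiProjPaper

variable (K : Type) [Field K] (k : ℕ) (n : Fin k → ℕ)

/-- Saturation of a multihomogeneous ideal with respect to the irrelevant ideal of the
multiprojective space (generated by the products of one variable from each group). -/
noncomputable def msat (J : Ideal (MPR K k n)) : Ideal (MPR K k n) :=
  Ideal.span {f | ∃ N : ℕ, ∀ g : Fin N → ∀ i : Fin k, Fin (n i + 1),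
    (∏ t : Fin N, ∏ i : Fin k, X (⟨i, g t i⟩ : MPIdx k n)) * f ∈ J}

end MultiProjPaper

namespace MultiProjPaper

section Cone

variable {K : Type} [Field K] {k : ℕ} {n : Fin k → ℕ}

/-- Restriction of a polynomial to the affine multicone over the point `P`. -/
noncomputable def coneHom (P : MPPoint K k n) : MPR K k n →ₐ[K] MvPolynomial (Fin k) K :=
  aeval (fun x => C (P.v x.1 x.2) * X x.1)

lemma eval_coneHom (P : MPPoint K k n) (lam : Fin k → K) (f : MPR K k n) :
    eval lam (coneHom P f) = coneEval K k n lam P f := by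
  simp only [coneHom, coneEval]
  rw [aeval_def, eval₂_eq_eval_map, ← eval₂_id, ← eval₂_id]
  induction f using MvPolynomial.induction_on with
  | C a => simp
  | add p q hp hq => simp_all
  | mul_X p x hp => simp_all [mul_comm]

lemma mem_vanIdeal_iff [Infinite K] {S : Set (MPPoint K k n)} {f : MPR K k n} :
    f ∈ vanIdeal K k n S ↔ ∀ P ∈ S, coneHom P f = 0 := by
  change (∀ P ∈ S, ∀ lam : Fin k → K, coneEval K k n lam P f = 0) ↔ _
  refine forall₂_congr fun P _ => ⟨fun h => MvPolynomial.funext fun lam => ?_, fun h lam => ?_⟩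
  · rw [eval_coneHom, h, map_zero]
  · rw [← eval_coneHom, h, map_zero]

lemma weight_mpWeight_apply (d : MPIdx k n →₀ ℕ) (j : Fin k) :
    Finsupp.weight (mpWeight k n) d j = ∑ t, d ⟨j, t⟩ := by
  rw [Finsupp.weight_apply, Finsupp.sum_fintype _ _ (by simp), Finset.sum_apply,
    Fintype.sum_sigma, Finset.sum_eq_single j]
  · simp [mpWeight]
  · intro i _ hi
    simp [mpWeight, Pi.single_eq_of_ne hi.symm]
  · simp

lemma coneHom_of_mem_mcomp (P : MPPoint K k n) {b : Fin k → ℕ} {f : MPR K k n}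
    (hf : f ∈ mcomp K k n b) :
    coneHom P f = monomial (Finsupp.equivFunOnFinite.symm b) (P.ev K k n f) := by
  have hf' : IsWeightedHomogeneous (mpWeight k n) f b := hf
  have key : ∀ d : MPIdx k n →₀ ℕ, coneHom P (monomial d 1) =
      monomial (Finsupp.equivFunOnFinite.symm (Finsupp.weight (mpWeight k n) d))
        (P.ev K k n (monomial d 1)) := by
    intro d
    have hw : (∏ x, (X x.1 : MvPolynomial (Fin k) K) ^ d x) =
        monomial (Finsupp.equivFunOnFinite.symm (Finsupp.weight (mpWeight k n) d)) 1 := by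
      rw [monomial_eq, Finsupp.prod_fintype _ _ (by simp), Fintype.prod_sigma]
      simp [weight_mpWeight_apply, Finset.prod_pow_eq_pow_sum]
    rw [coneHom, aeval_monomial, Finsupp.prod_fintype _ _ (by simp), MPPoint.ev, eval_monomial,
      Finsupp.prod_fintype _ _ (by simp)]
    simp only [mul_pow, Finset.prod_mul_distrib, hw, map_one, one_mul]
    rw [← mul_one (∏ x, P.v x.1 x.2 ^ d x), ← C_mul_monomial]
    simp
  rw [f.as_sum, map_sum, MPPoint.ev, map_sum, map_sum]
  refine Finset.sum_congr rfl fun d hd => ?_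
  have hd' := hf' (mem_support_iff.mp hd)
  have := key d
  rw [hd'] at this
  rw [← mul_one (coeff d f), ← C_mul_monomial, map_mul, this, map_mul, eval_C, ← C_mul_monomial,
    MPPoint.ev, coneHom, aeval_C, algebraMap_eq]

lemma mem_vanIdeal_iff_ev [Infinite K] {S : Set (MPPoint K k n)} {b : Fin k → ℕ} {f : MPR K k n}
    (hf : f ∈ mcomp K k n b) :
    f ∈ vanIdeal K k n S ↔ ∀ P ∈ S, P.ev K k n f = 0 := by
  rw [mem_vanIdeal_iff]
  refine forall₂_congr fun P _ => ?_
  rw [coneHom_of_mem_mcomp P hf, monomial_eq_zero]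

lemma weightedHomogeneousComponent_mem_vanIdeal [Infinite K] {S : Set (MPPoint K k n)}
    {f : MPR K k n} (hf : f ∈ vanIdeal K k n S) (c : Fin k → ℕ) :
    weightedHomogeneousComponent (mpWeight k n) c f ∈ vanIdeal K k n S := by
  rw [mem_vanIdeal_iff_ev (weightedHomogeneousComponent_mem (mpWeight k n) f c)]
  intro P hP
  have h0 := mem_vanIdeal_iff.mp hf P hP
  have hfin := weightedHomogeneousComponent_finsupp (w := mpWeight k n) f
  have hsum := sum_weightedHomogeneousComponent (mpWeight k n) f
  rw [finsum_eq_sum _ hfin] at hsum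
  rw [← hsum, map_sum, Finset.sum_congr rfl fun d _ => coneHom_of_mem_mcomp P
    (weightedHomogeneousComponent_mem (mpWeight k n) f d)] at h0
  have h1 := congrArg (coeff (Finsupp.equivFunOnFinite.symm c)) h0
  simp only [coeff_sum, coeff_monomial, coeff_zero, EmbeddingLike.apply_eq_iff_eq,
    Finset.sum_ite_eq'] at h1
  split_ifs at h1 with h
  · exact h1
  · have : weightedHomogeneousComponent (mpWeight k n) c f = 0 := by
      by_contra h'
      exact h (hfin.mem_toFinset.mpr h')
    rw [this, MPPoint.ev, map_zero]

end Cone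

end MultiProjPaper

namespace MultiProjPaper

section Separation

variable {K : Type} [Field K] {k : ℕ} {n : Fin k → ℕ}

/-- Forms of multidegree `b` take arbitrary values on the points `T t`, that is, the points
impose independent conditions on forms of multidegree `b`. -/
def Separates {s : ℕ} (T : Fin s → MPPoint K k n) (b : Fin k → ℕ) : Prop :=
  ∀ y : Fin s → K, ∃ h ∈ mcomp K k n b, ∀ t, (T t).ev K k n h = y t

lemma X_mem_mcomp (x : MPIdx k n) : (X x : MPR K k n) ∈ mcomp K k n (Pi.single x.1 1) :=
  isWeightedHomogeneous_X K (mpWeight k n) x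

lemma mul_mem_mcomp {f g : MPR K k n} {b c : Fin k → ℕ} (hf : f ∈ mcomp K k n b)
    (hg : g ∈ mcomp K k n c) : f * g ∈ mcomp K k n (b + c) :=
  IsWeightedHomogeneous.mul hf hg

lemma Separates.add {s : ℕ} {T : Fin s → MPPoint K k n} {b : Fin k → ℕ} (hb : Separates T b)
    (hT : ∀ t j, (T t).v j 0 ≠ 0) (c : Fin k → ℕ) : Separates T (b + c) := by
  intro y
  set m : MPR K k n := ∏ j, X ⟨j, 0⟩ ^ c j with hm
  have hmc : m ∈ mcomp K k n c := by
    have : IsWeightedHomogeneous (mpWeight k n) m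
        (∑ j, c j • mpWeight k n (⟨j, 0⟩ : MPIdx k n)) :=
      IsWeightedHomogeneous.prod _ _ _ fun j _ => (isWeightedHomogeneous_X K _ _).pow _
    change IsWeightedHomogeneous (mpWeight k n) _ _
    convert this
    ext j
    simp [mpWeight, Finset.sum_apply, Pi.single_apply]
  have hme : ∀ t, (T t).ev K k n m ≠ 0 := fun t => by
    simp [MPPoint.ev, hm, map_prod, Finset.prod_ne_zero_iff, hT]
  obtain ⟨h, hh, hy⟩ := hb fun t => y t / (T t).ev K k n m
  refine ⟨h * m, mul_mem_mcomp hh hmc, fun t => ?_⟩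
  have := hy t
  rw [MPPoint.ev] at this ⊢
  rw [map_mul, this]
  exact div_mul_cancel₀ _ (hme t)

/-- There are at least `∏ C(n_j + b_j, n_j)` monomials of multidegree `b`. -/
lemma exists_injective_weight_eq {s : ℕ} {b : Fin k → ℕ}
    (hs : s ≤ ∏ j, Nat.choose (n j + b j) (n j)) :
    ∃ e : Fin s → MPIdx k n →₀ ℕ, Function.Injective e ∧
      ∀ t, Finsupp.weight (mpWeight k n) (e t) = b := by
  classical
  have hcard : Fintype.card (∀ j, Sym (Fin (n j + 1)) (b j)) =
      ∏ j, Nat.choose (n j + b j) (n j) := by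
    rw [Fintype.card_pi]
    refine Finset.prod_congr rfl fun j _ => ?_
    rw [Sym.card_sym_eq_choose, Fintype.card_fin, show n j + 1 + b j - 1 = n j + b j by omega,
      Nat.choose_symm_add]
  obtain ⟨φ⟩ : Nonempty (Fin s ↪ ∀ j, Sym (Fin (n j + 1)) (b j)) :=
    Function.Embedding.nonempty_of_card_le (by rwa [hcard, Fintype.card_fin])
  refine ⟨fun t => Finsupp.equivFunOnFinite.symm
    fun x => Multiset.count x.2 (φ t x.1 : Multiset (Fin (n x.1 + 1))), fun t u htu => ?_,
    fun t => funext fun j => ?_⟩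
  · refine φ.injective (funext fun j => Sym.coe_injective (Multiset.ext.mpr fun x => ?_))
    exact DFunLike.congr_fun htu (⟨j, x⟩ : MPIdx k n)
  · rw [weight_mpWeight_apply]
    exact (Multiset.sum_count_eq_card fun _ _ => Finset.mem_univ _).trans (φ t j).2

/-- `s` general points impose independent conditions on forms of multidegree `b`, as soon as
there are at least `s` monomials of that multidegree. -/
lemma genericPts_separates {s : ℕ} {b : Fin k → ℕ}
    (hs : s ≤ ∏ j, Nat.choose (n j + b j) (n j)) :
    GenericPts K k n s fun T => Separates T b := by
  classical
  obtain ⟨e, he, hw⟩ := exists_injective_weight_eq hs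
  have hinj : ∀ t : Fin s, Function.Injective fun x : MPIdx k n => (t, x) :=
    fun t => Prod.mk_right_injective t
  let D : Equiv.Perm (Fin s) → (Fin s × MPIdx k n →₀ ℕ) :=
    fun σ => ∑ t, (e (σ t)).mapDomain fun x => (t, x)
  have hD : ∀ σ t x, D σ (t, x) = e (σ t) x := by
    intro σ t x
    simp only [D, Finsupp.finsetSum_apply]
    rw [Finset.sum_eq_single t]
    · exact Finsupp.mapDomain_apply (hinj t) _ _
    · intro u _ hu
      refine Finsupp.mapDomain_of_notMem_range _ _ ?_
      rintro ⟨z, hz⟩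
      exact hu (congrArg Prod.fst hz)
    · simp
  have hDinj : Function.Injective D := fun σ τ h =>
    Equiv.ext fun t => he <| Finsupp.ext fun x => by rw [← hD, h, hD]
  let M : Matrix (Fin s) (Fin s) (MvPolynomial (Fin s × MPIdx k n) K) :=
    Matrix.of fun u t => monomial ((e u).mapDomain fun x => (t, x)) 1
  have hdet : M.det =
      ∑ σ : Equiv.Perm (Fin s), monomial (D σ) (((Equiv.Perm.sign σ : ℤ) : K)) := by
    rw [Matrix.det_apply']
    refine Finset.sum_congr rfl fun σ _ => ?_
    simp only [M, Matrix.of_apply]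
    rw [← monomial_sum_one, ← map_intCast (C : K →+* MvPolynomial (Fin s × MPIdx k n) K),
      C_mul_monomial, mul_one]
  refine ⟨M.det, fun h0 => ?_, fun T hT y => ?_⟩
  · have := congrArg (coeff (D 1)) h0
    simp [hdet, coeff_sum, coeff_monomial, hDinj.eq_iff] at this
  · let N : Matrix (Fin s) (Fin s) K :=
      Matrix.of fun t u => (T t).ev K k n (monomial (e u) 1)
    have hN : N.det ≠ 0 := by
      convert hT
      rw [RingHom.map_det, ← Matrix.det_transpose]
      congr 1
      ext u t
      simp only [N, M, Matrix.transpose_apply, Matrix.of_apply, RingHom.mapMatrix_apply,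
        Matrix.map_apply, MPPoint.ev, eval_monomial]
      rw [Finsupp.prod_mapDomain_index_inj (hinj t)]
    have hu : IsUnit N.det := hN.isUnit
    refine ⟨∑ u, (N⁻¹.mulVec y) u • monomial (e u) 1, ?_, fun t => ?_⟩
    · refine Submodule.sum_mem _ fun u _ => Submodule.smul_mem _ _ ?_
      exact isWeightedHomogeneous_monomial _ _ _ (hw u)
    · have : N.mulVec (N⁻¹.mulVec y) t = y t := by
        rw [Matrix.mulVec_mulVec, Matrix.mul_nonsing_inv _ hu, Matrix.one_mulVec]
      rw [← this, MPPoint.ev, map_sum, Matrix.mulVec, dotProduct]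
      refine Finset.sum_congr rfl fun u _ => ?_
      rw [smul_eval, mul_comm]
      rfl

lemma GenericPts.and {s : ℕ} {P Q : (Fin s → MPPoint K k n) → Prop}
    (hP : GenericPts K k n s P) (hQ : GenericPts K k n s Q) :
    GenericPts K k n s fun T => P T ∧ Q T := by
  obtain ⟨F, hF, hFP⟩ := hP
  obtain ⟨G, hG, hGQ⟩ := hQ
  refine ⟨F * G, mul_ne_zero hF hG, fun T hT => ?_⟩
  rw [map_mul] at hT
  exact ⟨hFP T (left_ne_zero_of_mul hT), hGQ T (right_ne_zero_of_mul hT)⟩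

lemma GenericPts.forall {ι : Type} [Fintype ι] {s : ℕ}
    {P : ι → (Fin s → MPPoint K k n) → Prop} (hP : ∀ j, GenericPts K k n s (P j)) :
    GenericPts K k n s fun T => ∀ j, P j T := by
  choose F hF hFP using hP
  refine ⟨∏ j, F j, Finset.prod_ne_zero_iff.mpr fun j _ => hF j, fun T hT j => hFP j T ?_⟩
  rw [map_prod] at hT
  exact Finset.prod_ne_zero_iff.mp hT j (Finset.mem_univ j)

lemma GenericPts.mono {s : ℕ} {P Q : (Fin s → MPPoint K k n) → Prop}
    (hP : GenericPts K k n s P) (h : ∀ T, P T → Q T) : GenericPts K k n s Q := by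
  obtain ⟨F, hF, hFP⟩ := hP
  exact ⟨F, hF, fun T hT => h T (hFP T hT)⟩

lemma genericPts_coord_ne_zero {s : ℕ} (t : Fin s) (j : Fin k) :
    GenericPts K k n s fun T => (T t).v j 0 ≠ 0 :=
  ⟨X (t, ⟨j, 0⟩), X_ne_zero _, fun T hT => by simpa using hT⟩

end Separation

section Generation

variable {K : Type} [Field K] [Infinite K] {k : ℕ} {n : Fin k → ℕ} {s : ℕ}
  {T : Fin s → MPPoint K k n}

/-- If the points impose independent conditions on forms of multidegree `b`, then their ideal in
multidegree `b + 2ε_j` is generated by that in multidegree `b + ε_j`. -/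
lemma secI_vanIdeal_le_of_separates (hT : ∀ t j, (T t).v j 0 ≠ 0) {b : Fin k → ℕ}
    (hb : Separates T b) (j : Fin k) {J : Ideal (MPR K k n)}
    (hJI : J ≤ vanIdeal K k n (Set.range T))
    (hJ : ∀ f ∈ secI K k n (vanIdeal K k n (Set.range T)) (b + Pi.single j 1), f ∈ J) :
    ∀ f ∈ secI K k n (vanIdeal K k n (Set.range T)) (b + Pi.single j 1 + Pi.single j 1),
      f ∈ J := by
  set ℓ : MPR K k n := X ⟨j, 0⟩ with hℓ
  have hℓc : ℓ ∈ mcomp K k n (Pi.single j 1) := X_mem_mcomp _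
  have hℓe : ∀ t, eval (fun x : MPIdx k n => (T t).v x.1 x.2) ℓ = (T t).v j 0 :=
    fun t => by simp [hℓ]
  have hred : ∀ g ∈ mcomp K k n (b + Pi.single j 1),
      ∃ h ∈ mcomp K k n b, g - h * ℓ ∈ J := by
    intro g hg
    obtain ⟨h, hh, hy⟩ := hb fun t => (T t).ev K k n g / (T t).v j 0
    refine ⟨h, hh, hJ _ ?_⟩
    have hmem := Submodule.sub_mem _ hg (mul_mem_mcomp hh hℓc)
    refine ⟨hmem, (mem_vanIdeal_iff_ev hmem).mpr ?_⟩
    rintro _ ⟨t, rfl⟩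
    have := hy t
    rw [MPPoint.ev] at this ⊢
    rw [map_sub, map_mul, this, hℓe, div_mul_cancel₀ _ (hT t j), MPPoint.ev, sub_self]
  have hred' : ∀ f ∈ mcomp K k n (b + Pi.single j 1 + Pi.single j 1),
      ∃ h ∈ mcomp K k n (b + Pi.single j 1), f - h * ℓ ∈ J := by
    intro f hf
    have hf' : IsWeightedHomogeneous (mpWeight k n) f (b + Pi.single j 1 + Pi.single j 1) := hf
    induction hf' using IsWeightedHomogeneous.induction_on with
    | zero => exact ⟨0, Submodule.zero_mem _, by simp⟩
    | add p q hp hq ihp ihq =>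
      obtain ⟨h, hh, h1⟩ := ihp hp
      obtain ⟨h', hh', h1'⟩ := ihq hq
      refine ⟨h + h', Submodule.add_mem _ hh hh', ?_⟩
      convert J.add_mem h1 h1' using 1
      ring
    | monomial d r hd =>
      have hdj : 0 < ∑ t, d ⟨j, t⟩ := by
        rw [← weight_mpWeight_apply, hd]
        simp
      obtain ⟨t, -, ht⟩ := Finset.exists_ne_zero_of_sum_ne_zero hdj.ne'
      have hle : Finsupp.single (⟨j, t⟩ : MPIdx k n) 1 ≤ d := by
        rw [Finsupp.single_le_iff]
        exact Nat.one_le_iff_ne_zero.mpr ht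
      obtain ⟨d', rfl⟩ := exists_add_of_le hle
      have hd' : Finsupp.weight (mpWeight k n) d' = b + Pi.single j 1 := by
        rw [map_add, Finsupp.weight_single, add_comm] at hd
        refine add_right_cancel (b := Pi.single j 1) ?_
        simpa [mpWeight] using hd
      obtain ⟨h, hh, h1⟩ := hred (monomial d' r) (isWeightedHomogeneous_monomial _ _ _ hd')
      refine ⟨h * X ⟨j, t⟩, mul_mem_mcomp hh (X_mem_mcomp _), ?_⟩
      convert J.mul_mem_left (X ⟨j, t⟩) h1 using 1
      rw [add_comm, monomial_add_single, pow_one]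
      ring
  rintro f ⟨hf, hfI⟩
  obtain ⟨h, hh, h1⟩ := hred' f hf
  have h2 : h * ℓ ∈ vanIdeal K k n (Set.range T) := by
    have := Ideal.sub_mem _ hfI (hJI h1)
    rwa [sub_sub_cancel] at this
  have h3 : h ∈ vanIdeal K k n (Set.range T) := by
    rw [mem_vanIdeal_iff_ev (mul_mem_mcomp hh hℓc)] at h2
    rw [mem_vanIdeal_iff_ev hh]
    rintro _ ⟨t, rfl⟩
    have := h2 _ ⟨t, rfl⟩
    rw [MPPoint.ev, map_mul, hℓe] at this
    exact (mul_eq_zero.mp this).resolve_right (hT t j)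
  have := J.add_mem h1 (J.mul_mem_right ℓ (hJ h ⟨hh, h3⟩))
  rwa [sub_add_cancel] at this

/-- If the points impose independent conditions in multidegrees `a` and `a + (r + 1)ε_i - ε_j` for
all `j`, then their ideal in multidegree `a + ε_i` generates it in all multidegrees
`c ≥ a + (r + 1)ε_i`. -/
lemma secI_vanIdeal_le_span (hT : ∀ t j, (T t).v j 0 ≠ 0) {a : Fin k → ℕ} (ha : ∀ j, 0 < a j)
    (i : Fin k) (r : ℕ) (h0 : Separates T a)
    (h1 : ∀ j, Separates T (a + Pi.single i (r + 1) - Pi.single j 1)) (d : Fin k → ℕ) :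
    ∀ f ∈ secI K k n (vanIdeal K k n (Set.range T)) (a + Pi.single i (r + 1) + d),
      f ∈ Ideal.span (↑(secI K k n (vanIdeal K k n (Set.range T)) (a + Pi.single i 1)) :
        Set (MPR K k n)) := by
  set J := Ideal.span (↑(secI K k n (vanIdeal K k n (Set.range T)) (a + Pi.single i 1)) :
    Set (MPR K k n)) with hJ
  have hJI : J ≤ vanIdeal K k n (Set.range T) := Ideal.span_le.mpr fun f hf => hf.2
  have base : ∀ m : ℕ, ∀ f ∈ secI K k n (vanIdeal K k n (Set.range T)) (a + Pi.single i (m + 1)),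
      f ∈ J := by
    intro m
    induction m with
    | zero => exact fun f hf => Ideal.subset_span hf
    | succ m ih =>
      have := secI_vanIdeal_le_of_separates hT (h0.add hT (Pi.single i m)) i hJI
      simp only [add_assoc, ← Pi.single_add] at this
      exact this ih
  have step : ∀ (e : Fin k → ℕ) (j : Fin k),
      (∀ f ∈ secI K k n (vanIdeal K k n (Set.range T)) (a + Pi.single i (r + 1) + e), f ∈ J) →
      ∀ f ∈ secI K k n (vanIdeal K k n (Set.range T))
        (a + Pi.single i (r + 1) + e + Pi.single j 1), f ∈ J := by
    intro e j ih
    have := secI_vanIdeal_le_of_separates hT ((h1 j).add hT e) j hJI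
    have hle : Pi.single j 1 ≤ a + Pi.single i (r + 1) := by
      intro l
      obtain rfl | hl := eq_or_ne l j
      · rw [Pi.single_eq_same]
        exact Nat.le_add_right_of_le (ha l)
      · simp [Pi.single_eq_of_ne hl]
    rw [add_right_comm _ e, tsub_add_cancel_of_le hle] at this
    exact this ih
  have many : ∀ (u : Finset (Fin k)),
      ∀ f ∈ secI K k n (vanIdeal K k n (Set.range T))
        (a + Pi.single i (r + 1) + ∑ j ∈ u, Pi.single j (d j)), f ∈ J := by
    intro u
    induction u using Finset.induction_on with
    | empty => simpa using base r
    | insert j u hj ih =>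
      rw [Finset.sum_insert hj, add_comm (Pi.single j (d j) : Fin k → ℕ)]
      generalize d j = q
      induction q with
      | zero => simpa using ih
      | succ q ihq =>
        rw [Pi.single_add j, ← add_assoc, ← add_assoc]
        rw [← add_assoc] at ihq
        have := step (∑ j ∈ u, Pi.single j (d j) + Pi.single j q) j
        rw [← add_assoc] at this
        exact this ihq
  have := many Finset.univ
  rwa [Finset.univ_sum_single] at this

/-- The ideal of a set of points is saturated. -/
lemma msat_le_vanIdeal (hT : ∀ t j, (T t).v j 0 ≠ 0) {J : Ideal (MPR K k n)}
    (hJ : J ≤ vanIdeal K k n (Set.range T)) : msat K k n J ≤ vanIdeal K k n (Set.range T) := by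
  refine Ideal.span_le.mpr ?_
  rintro f ⟨N, hN⟩
  refine mem_vanIdeal_iff.mpr ?_
  rintro _ ⟨t, rfl⟩
  have := mem_vanIdeal_iff.mp (hJ (hN fun _ _ => 0)) _ ⟨t, rfl⟩
  rw [map_mul] at this
  refine (mul_eq_zero.mp this).resolve_left ?_
  simp [coneHom, map_prod, Finset.prod_ne_zero_iff, hT]

/-- An ideal containing all large enough multihomogeneous components of the ideal of a set of
points has a saturation containing this ideal. -/
lemma vanIdeal_le_msat {S : Set (MPPoint K k n)} {J : Ideal (MPR K k n)} (c : Fin k → ℕ)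
    (hJ : ∀ d, ∀ f ∈ secI K k n (vanIdeal K k n S) (c + d), f ∈ J) :
    vanIdeal K k n S ≤ msat K k n J := by
  intro f hf
  have hfin := weightedHomogeneousComponent_finsupp (w := mpWeight k n) f
  rw [← sum_weightedHomogeneousComponent (mpWeight k n) f, finsum_eq_sum _ hfin]
  refine Ideal.sum_mem _ fun e _ => Ideal.subset_span ⟨∑ j, c j, fun g => ?_⟩
  have hm : (∏ t, ∏ j, X (⟨j, g t j⟩ : MPIdx k n) : MPR K k n) ∈
      mcomp K k n (fun _ => ∑ j, c j) := by
    have : IsWeightedHomogeneous (mpWeight k n)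
        (∏ t, ∏ j, X (⟨j, g t j⟩ : MPIdx k n) : MPR K k n)
        (∑ t, ∑ j, mpWeight k n (⟨j, g t j⟩ : MPIdx k n)) :=
      IsWeightedHomogeneous.prod _ _ _ fun t _ =>
        IsWeightedHomogeneous.prod _ _ _ fun j _ => isWeightedHomogeneous_X K _ _
    change IsWeightedHomogeneous (mpWeight k n) _ _
    convert this using 1
    ext j
    simp [mpWeight, Finset.sum_apply, Pi.single_apply]
  have hle : c ≤ fun _ => ∑ j, c j := fun j =>
    Finset.single_le_sum (f := c) (fun _ _ => Nat.zero_le _) (Finset.mem_univ j)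
  obtain ⟨d, hd⟩ := exists_add_of_le hle
  have hmul := mul_mem_mcomp hm (weightedHomogeneousComponent_mem (mpWeight k n) f e)
  rw [hd, add_assoc] at hmul
  exact hJ _ _ ⟨hmul, Ideal.mul_mem_left _ _ (weightedHomogeneousComponent_mem_vanIdeal hf e)⟩

end Generation

lemma le_prod_choose {k : ℕ} {n b : Fin k → ℕ} {i : Fin k} (hi : 1 ≤ n i) :
    b i ≤ ∏ j, Nat.choose (n j + b j) (n j) := by
  calc b i ≤ Nat.choose (1 + b i) (b i) := by simp [add_comm 1]
    _ ≤ Nat.choose (n i + b i) (b i) := Nat.choose_le_choose _ (by omega)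
    _ = Nat.choose (n i + b i) (n i) := Nat.choose_symm_add.symm
    _ ≤ _ := Finset.single_le_prod' (f := fun j => Nat.choose (n j + b j) (n j))
      (fun j _ => Nat.choose_pos (by omega)) (Finset.mem_univ i)

end MultiProjPaper

namespace MultiProjPaper

/-- Corollary `f4`.
Let `X = ℙ^{n_1} × ⋯ × ℙ^{n_k}`, `k ≥ 2`, over an algebraically closed field `K` of
characteristic `0`. Fix `a ∈ ℕ^k` with all `a_i > 0`, an integer `s` with
`0 < s < ∏ C(n_i + a_i, n_i)`, and an index `i`. Let `Z ⊂ X` be a general subset of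
cardinality `s`. Then `Z` equals the scheme-theoretic base locus of `|𝓘_Z(a + ε_i)|`:
the saturation of the ideal generated by `H^0(𝓘_Z(a + ε_i))` equals the saturated ideal
of `Z`. -/
theorem statement19 (K : Type) [Field K] [IsAlgClosed K] [CharZero K]
    (k : ℕ) (hk : 2 ≤ k) (n : Fin k → ℕ) (hn : ∀ i, 1 ≤ n i)
    (a : Fin k → ℕ) (ha : ∀ i, 0 < a i) (s : ℕ) (hs : 0 < s)
    (hs' : s < ∏ i, Nat.choose (n i + a i) (n i)) (i : Fin k) :
    GenericPts K k n s (fun T =>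
      msat K k n
        (Ideal.span
          (↑(secI K k n (vanIdeal K k n (Set.range T)) (a + Pi.single i 1)) :
            Set (MPR K k n))) =
      vanIdeal K k n (Set.range T)) := by
  have hsep : ∀ j, s ≤ ∏ l, Nat.choose
      (n l + (a + Pi.single i (s + 1) - Pi.single j 1 : Fin k → ℕ) l) (n l) := by
    intro j
    refine le_trans ?_ (le_prod_choose (hn i))
    have : (Pi.single j 1 : Fin k → ℕ) i ≤ 1 := by
      rw [Pi.single_apply]
      split_ifs <;> omega
    simp only [Pi.sub_apply, Pi.add_apply, Pi.single_eq_same]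
    omega
  have hgen := ((GenericPts.forall fun t => GenericPts.forall fun j =>
      genericPts_coord_ne_zero (K := K) (n := n) t j).and
    (genericPts_separates (K := K) hs'.le)).and
    (GenericPts.forall fun j => genericPts_separates (K := K)
      (b := a + Pi.single i (s + 1) - Pi.single j 1) (hsep j))
  refine hgen.mono ?_
  rintro T ⟨⟨hT, h0⟩, h1⟩
  refine le_antisymm (msat_le_vanIdeal hT ?_) ?_
  · rw [Ideal.span_le]
    exact fun f hf => hf.2
  · exact vanIdeal_le_msat _ (secI_vanIdeal_le_span hT ha i s h0 h1)

end MultiProjPaper
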